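/- Let d ≥ 1, let Γ be an additive sub-semigroup of ℕ^{d+1} that generates ℤ^{d+1} as a group, and let F : Γ → ℝ be subadditive and satisfy F(γ) ≥ C·|γ| for all γ ∈ Γ, for some real constant C. Then for every α in the interior of Δ(Γ) the following holds: for every sequence of positive integers m_k tending to infinity and every sequence α_k ∈ Λ_{m_k}(Γ) converging to α in the Euclidean topology, the sequence F((m_k α_k, m_k)) / m_k converges, and its limit depends only on α (not on the choice of the sequence (m_k, α_k)). In particular, a well-defined function c : Δ(Γ)° → ℝ is obtained, c(α) := lim_{k→∞} F((m_k α_k, m_k)) / m_k. -/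

import Mathlib

open Filter Topology

/-- The image of a vector of natural numbers in `ℝ^n`. -/
def natVecR {n : ℕ} (γ : Fin n → ℕ) : Fin n → ℝ := fun i => (γ i : ℝ)

/-- `Σ(Γ)`: the closed convex cone generated by `Γ ⊆ ℕ^n` in `ℝ^n`, i.e. the topological
closure of the set of all finite nonnegative real linear combinations of elements of `Γ`. -/
def coneOf {n : ℕ} (Γ : Set (Fin n → ℕ)) : Set (Fin n → ℝ) :=
  closure { x | ∃ (k : ℕ) (c : Fin k → ℝ) (g : Fin k → (Fin n → ℕ)),
    (∀ i, 0 ≤ c i) ∧ (∀ i, g i ∈ Γ) ∧ x = ∑ i, c i • natVecR (g i) }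

/-- `Δ(Γ) = {x ∈ ℝ^d : (x,1) ∈ Σ(Γ)}`. -/
def deltaOf {d : ℕ} (Γ : Set (Fin (d+1) → ℕ)) : Set (Fin d → ℝ) :=
  { x | Fin.snoc x (1 : ℝ) ∈ coneOf Γ }

lemma cheb_diff {n : ℕ} (Γ : Set (Fin n → ℕ)) (h0 : (0 : Fin n → ℕ) ∈ Γ)
    (hadd : ∀ x ∈ Γ, ∀ y ∈ Γ, x + y ∈ Γ)
    (hgen : AddSubgroup.closure
        ((fun γ : Fin n → ℕ => (fun i => (γ i : ℤ))) '' Γ) = ⊤) (v : Fin n → ℤ) :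
    ∃ a ∈ Γ, ∃ b ∈ Γ, ∀ i, v i = (a i : ℤ) - b i := by
  have hv : v ∈ AddSubgroup.closure
        ((fun γ : Fin n → ℕ => (fun i => (γ i : ℤ))) '' Γ) := by rw [hgen]; trivial
  induction hv using AddSubgroup.closure_induction with
  | mem x hx =>
    obtain ⟨a, ha, rfl⟩ := hx
    exact ⟨a, ha, 0, h0, fun i => by simp⟩
  | zero => exact ⟨0, h0, 0, h0, fun i => by simp⟩
  | add x y _ _ hx hy =>
    obtain ⟨a, ha, b, hb, h1⟩ := hx
    obtain ⟨a', ha', b', hb', h2⟩ := hy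
    refine ⟨a + a', hadd _ ha _ ha', b + b', hadd _ hb _ hb', fun i => ?_⟩
    simp only [Pi.add_apply, h1, h2]; push_cast; ring
  | neg x _ hx =>
    obtain ⟨a, ha, b, hb, h1⟩ := hx
    exact ⟨b, hb, a, ha, fun i => by simp [h1]⟩

lemma cheb_nsmul {n : ℕ} (Γ : Set (Fin n → ℕ))
    (hadd : ∀ x ∈ Γ, ∀ y ∈ Γ, x + y ∈ Γ) (F : (Fin n → ℕ) → ℝ)
    (hsub : ∀ x ∈ Γ, ∀ y ∈ Γ, F (x + y) ≤ F x + F y)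
    (g : Fin n → ℕ) (hg : g ∈ Γ) (x : Fin n → ℕ) (hx : x ∈ Γ) (k : ℕ) :
    k • g + x ∈ Γ ∧ F (k • g + x) ≤ k * F g + F x := by
  induction k with
  | zero => simpa using hx
  | succ k ih =>
    have e : (k + 1) • g + x = g + (k • g + x) := by rw [succ_nsmul]; abel
    rw [e]
    refine ⟨hadd _ hg _ ih.1, (hsub _ hg _ ih.1).trans ?_⟩
    push_cast; linarith [ih.2]

lemma cheb_sum {n : ℕ} (Γ : Set (Fin n → ℕ))
    (hadd : ∀ x ∈ Γ, ∀ y ∈ Γ, x + y ∈ Γ) (F : (Fin n → ℕ) → ℝ)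
    (hsub : ∀ x ∈ Γ, ∀ y ∈ Γ, F (x + y) ≤ F x + F y) {ι : Type} (s : Finset ι)
    (g : ι → Fin n → ℕ) (hg : ∀ i, g i ∈ Γ) (x : Fin n → ℕ) (hx : x ∈ Γ) (k : ι → ℕ) :
    ∑ i ∈ s, k i • g i + x ∈ Γ ∧
      F (∑ i ∈ s, k i • g i + x) ≤ ∑ i ∈ s, k i * F (g i) + F x := by
  classical
  induction s using Finset.induction_on with
  | empty => simpa using hx
  | insert i s hi ih =>
    rw [Finset.sum_insert hi, Finset.sum_insert hi, add_assoc]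
    have := cheb_nsmul Γ hadd F hsub (g i) (hg i) _ ih.1 (k i)
    exact ⟨this.1, by linarith [this.2, ih.2]⟩

/-- Representation of an interior point. -/
lemma cheb_rep {d : ℕ} (Γ : Set (Fin (d+1) → ℕ)) (a b : Fin (d+1) → Fin (d+1) → ℕ)
    (hab : ∀ j i, (if i = j then (1:ℤ) else 0) = (a j i : ℤ) - b j i)
    (α : Fin d → ℝ) (hα : α ∈ interior (deltaOf Γ)) :
    ∃ (ε : ℝ) (u v : Fin (d+1) → ℝ) (k : ℕ) (c : Fin k → ℝ) (g : Fin k → (Fin (d+1) → ℕ)),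
      0 < ε ∧ (∀ j, ε ≤ u j) ∧ (∀ j, ε ≤ v j) ∧ (∀ i, 0 ≤ c i) ∧ (∀ i, g i ∈ Γ) ∧
      ∀ l, (Fin.snoc α (1:ℝ) : Fin (d+1) → ℝ) l =
        ∑ j, u j * (a j l : ℝ) + ∑ j, v j * (b j l : ℝ) + ∑ i, c i * (g i l : ℝ) := by
  set e : Fin (d+1) → ℝ := fun l => ∑ j, ((a j l : ℝ) + b j l) with he
  have hscale : ∀ s : ℝ, 0 ≤ s → ∀ x ∈ coneOf Γ, s • x ∈ coneOf Γ := by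
    intro s hs x hx
    refine map_mem_closure (f := fun x : Fin (d+1) → ℝ => s • x) (by fun_prop) hx ?_
    rintro x ⟨k, c, g, hc, hg, rfl⟩
    refine ⟨k, fun i => s * c i, g, fun i => mul_nonneg hs (hc i), hg, ?_⟩
    simp [Finset.smul_sum, smul_smul]
  obtain ⟨ε, hε, hmem⟩ : ∃ ε : ℝ, 0 < ε ∧
      (fun l => (Fin.snoc α (1:ℝ) : Fin (d+1) → ℝ) l - 2 * ε * e l) ∈ coneOf Γ := by
    have c1 : ContinuousAt (fun ε : ℝ => fun i : Fin d =>
        (α i - 2 * ε * e i.castSucc) / (1 - 2 * ε * e (Fin.last d))) 0 := by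
      apply continuousAt_pi.2
      intro i
      apply ContinuousAt.div (by fun_prop) (by fun_prop)
      simp
    have c2 : ContinuousAt (fun ε : ℝ => 1 - 2 * ε * e (Fin.last d)) 0 := by fun_prop
    have e1 : ∀ᶠ ε : ℝ in 𝓝 0, (fun i : Fin d =>
        (α i - 2 * ε * e i.castSucc) / (1 - 2 * ε * e (Fin.last d))) ∈ interior (deltaOf Γ) := by
      apply c1.eventually_mem
      apply isOpen_interior.mem_nhds
      simpa using hα
    have e2 : ∀ᶠ ε : ℝ in 𝓝 0, 0 < 1 - 2 * ε * e (Fin.last d) := by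
      apply c2.eventually_mem
      apply isOpen_Ioi.mem_nhds
      simp
    have e3 : ∀ᶠ ε : ℝ in 𝓝[>] 0, 0 < ε := eventually_mem_nhdsWithin
    obtain ⟨ε, ⟨h1, h2⟩, h3⟩ :=
      (((e1.and e2).filter_mono nhdsWithin_le_nhds).and e3).exists
    refine ⟨ε, h3, ?_⟩
    have h5 := interior_subset h1
    simp only [deltaOf, Set.mem_setOf_eq] at h5
    have h4 := hscale _ h2.le _ h5
    convert h4 using 1
    funext l
    refine Fin.lastCases ?_ (fun i => ?_) l
    · simp
    · simp
      field_simp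
  obtain ⟨y, hy, hdist⟩ := Metric.mem_closure_iff.1 hmem ε hε
  obtain ⟨k, c, g, hc, hg, rfl⟩ := hy
  set z : Fin (d+1) → ℝ := fun l => (Fin.snoc α (1:ℝ) : Fin (d+1) → ℝ) l - 2 * ε * e l -
    ∑ i, c i * (g i l : ℝ) with hz
  have hzb : ∀ l, |z l| ≤ ε := by
    intro l
    have := (dist_le_pi_dist _ _ l).trans hdist.le
    rw [Real.dist_eq] at this
    simpa [hz, natVecR, Finset.sum_apply] using this
  refine ⟨ε, fun j => 2 * ε + z j, fun j => 2 * ε - z j, k, c, g, hε, ?_, ?_, hc, hg, ?_⟩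
  · intro j; linarith [(abs_le.1 (hzb j)).1]
  · intro j; linarith [(abs_le.1 (hzb j)).2]
  · intro l
    have h1 : ∑ j, (2 * ε + z j) * (a j l : ℝ) + ∑ j, (2 * ε - z j) * (b j l : ℝ)
        = 2 * ε * e l + z l := by
      have h2 : ∑ j, z j * (if l = j then (1:ℝ) else 0) = z l := by simp
      rw [← h2, he, Finset.mul_sum, ← Finset.sum_add_distrib, ← Finset.sum_add_distrib]
      refine Finset.sum_congr rfl fun j _ => ?_
      have h3 : (if l = j then (1:ℝ) else 0) = (a j l : ℝ) - b j l := by exact_mod_cast hab j l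
      rw [h3]; ring
    rw [h1, hz]; ring

/-- Key lemma: lattice points near the ray of an interior point are in `Γ` with linear bound. -/
lemma cheb_key {d : ℕ} (Γ : Set (Fin (d+1) → ℕ))
    (h0 : (0 : Fin (d+1) → ℕ) ∈ Γ)
    (hadd : ∀ x ∈ Γ, ∀ y ∈ Γ, x + y ∈ Γ)
    (hgen : AddSubgroup.closure
        ((fun γ : Fin (d+1) → ℕ => (fun i => (γ i : ℤ))) '' Γ) = ⊤)
    (F : (Fin (d+1) → ℕ) → ℝ)
    (hsub : ∀ x ∈ Γ, ∀ y ∈ Γ, F (x + y) ≤ F x + F y)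
    (α : Fin d → ℝ) (hα : α ∈ interior (deltaOf Γ)) :
    ∃ δ A R : ℝ, 0 < δ ∧ 0 ≤ A ∧ 0 < R ∧ ∀ t : ℝ, R ≤ t → ∀ ρ : Fin (d+1) → ℤ,
      (∀ l, |(ρ l : ℝ) - t * (Fin.snoc α (1:ℝ) : Fin (d+1) → ℝ) l| ≤ δ * t) →
      ∃ x ∈ Γ, (∀ l, (x l : ℤ) = ρ l) ∧ F x ≤ A * t := by
  choose a ha b hb hab using
    fun j : Fin (d+1) => cheb_diff Γ h0 hadd hgen (fun i => if i = j then 1 else 0)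
  obtain ⟨ε, u, v, k, c, g, hε, hu, hv, hc, hg, hp⟩ := cheb_rep Γ a b hab α hα
  set p : Fin (d+1) → ℝ := Fin.snoc α (1:ℝ) with hpdef
  set e : Fin (d+1) → ℝ := fun l => ∑ j, (a j l : ℝ) + ∑ j, (b j l : ℝ) + ∑ i, (g i l : ℝ) with he
  set M : ℝ := ∑ l, e l with hM
  have he0 : ∀ l, 0 ≤ e l := fun l => by simp only [he]; positivity
  have hM0 : 0 ≤ M := Finset.sum_nonneg fun l _ => he0 l
  have heM : ∀ l, e l ≤ M := fun l =>
    Finset.single_le_sum (f := e) (fun l _ => he0 l) (Finset.mem_univ l)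
  set A : ℝ := ∑ j, (u j + ε) * |F (a j)| + ∑ j, (v j + ε) * |F (b j)| +
    ∑ i, c i * |F (g i)| + |F 0| with hA
  have hu0 : ∀ j, 0 ≤ u j := fun j => hε.le.trans (hu j)
  have hv0 : ∀ j, 0 ≤ v j := fun j => hε.le.trans (hv j)
  refine ⟨ε / 2, A, 1 + 2 * (M + 1) / ε, by positivity, ?_, by positivity, ?_⟩
  · have h1 : 0 ≤ ∑ j, (u j + ε) * |F (a j)| := Finset.sum_nonneg fun j _ => by
      have := hu0 j; positivity
    have h2 : 0 ≤ ∑ j, (v j + ε) * |F (b j)| := Finset.sum_nonneg fun j _ => by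
      have := hv0 j; positivity
    have h3 : 0 ≤ ∑ i, c i * |F (g i)| := Finset.sum_nonneg fun j _ => by
      have := hc j; positivity
    positivity
  intro t ht ρ hρ
  have htp : 2 * (M + 1) / ε ≤ t := by linarith
  rw [div_le_iff₀ hε] at htp
  have ht1 : 1 ≤ t := le_trans (by have : 0 ≤ 2 * (M + 1) / ε := by positivity
                                   linarith) ht
  have ht0 : 0 ≤ t := by linarith
  set U : Fin (d+1) → ℤ := fun j => ⌊t * u j⌋
  set V : Fin (d+1) → ℤ := fun j => ⌊t * v j⌋
  set N : Fin k → ℕ := fun i => ⌊t * c i⌋₊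
  have hU1 : ∀ j, (U j : ℝ) ≤ t * u j := fun j => Int.floor_le _
  have hU2 : ∀ j, t * u j - 1 ≤ (U j : ℝ) := fun j => (Int.sub_one_lt_floor _).le
  have hV1 : ∀ j, (V j : ℝ) ≤ t * v j := fun j => Int.floor_le _
  have hV2 : ∀ j, t * v j - 1 ≤ (V j : ℝ) := fun j => (Int.sub_one_lt_floor _).le
  have hN1 : ∀ i, (N i : ℝ) ≤ t * c i := fun j => Nat.floor_le (mul_nonneg ht0 (hc j))
  have hN2 : ∀ i, t * c i - 1 ≤ (N i : ℝ) := fun j => (Nat.sub_one_lt_floor _).le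
  set r : Fin (d+1) → ℤ := fun l =>
    ρ l - (∑ j, U j * (a j l : ℤ) + ∑ j, V j * (b j l : ℤ) + ∑ i, (N i : ℤ) * (g i l : ℤ)) with hr
  have hrb : ∀ l, |(r l : ℝ)| ≤ ε / 2 * t + M := by
    intro l
    have h1 : ∀ {ι : Type} [Fintype ι] (W : ι → ℝ) (w : ι → ℝ) (q : ι → ℕ),
        (∀ j, W j ≤ t * w j) → (∀ j, t * w j - 1 ≤ W j) →
        0 ≤ t * ∑ j, w j * (q j : ℝ) - ∑ j, W j * (q j : ℝ) ∧
        t * ∑ j, w j * (q j : ℝ) - ∑ j, W j * (q j : ℝ) ≤ ∑ j, (q j : ℝ) := by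
      intro ι _ W w q h1 h2
      rw [Finset.mul_sum, ← Finset.sum_sub_distrib]
      constructor
      · refine Finset.sum_nonneg fun j _ => ?_
        have := mul_le_mul_of_nonneg_right (h1 j) (Nat.cast_nonneg (α := ℝ) (q j))
        linarith
      · refine Finset.sum_le_sum fun j _ => ?_
        have := mul_le_mul_of_nonneg_right (h2 j) (Nat.cast_nonneg (α := ℝ) (q j))
        linarith
    have ia := h1 (fun j => (U j : ℝ)) u (fun j => a j l) hU1 hU2
    have ib := h1 (fun j => (V j : ℝ)) v (fun j => b j l) hV1 hV2
    have ic := h1 (fun j => (N j : ℝ)) c (fun j => g j l) hN1 hN2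
    have hρl := abs_le.1 (hρ l)
    rw [hp l] at hρl
    have hel := heM l
    simp only [he] at hel
    have hrl : (r l : ℝ) = ρ l - (∑ j, (U j:ℝ) * (a j l : ℝ) + ∑ j, (V j:ℝ) * (b j l : ℝ) +
      ∑ i, (N i : ℝ) * (g i l : ℝ)) := by simp only [hr]; push_cast; rfl
    rw [hrl, abs_le]
    constructor <;> linarith [ia.1, ia.2, ib.1, ib.2, ic.1, ic.2, hρl.1, hρl.2]
  have hbig : ∀ w, ε ≤ w → ε / 2 * t + M ≤ t * w - 1 := by
    intro w hw
    have := mul_le_mul_of_nonneg_left hw ht0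
    linarith
  have hbig2 : ε / 2 * t + M ≤ t * ε := by linarith [hbig ε le_rfl]
  have hP : ∀ j, 0 ≤ U j + r j := fun j => by
    have : (0:ℝ) ≤ U j + r j := by
      linarith [hU2 j, hbig _ (hu j), (abs_le.1 (hrb j)).1]
    exact_mod_cast this
  have hQ : ∀ j, 0 ≤ V j - r j := fun j => by
    have : (0:ℝ) ≤ V j - r j := by
      linarith [hV2 j, hbig _ (hv j), (abs_le.1 (hrb j)).2]
    exact_mod_cast this
  choose P hPe using fun j => Int.eq_ofNat_of_zero_le (hP j)
  choose Q hQe using fun j => Int.eq_ofNat_of_zero_le (hQ j)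
  have s1 := cheb_sum Γ hadd F hsub Finset.univ g hg 0 h0 N
  have s2 := cheb_sum Γ hadd F hsub Finset.univ b hb _ s1.1 Q
  have s3 := cheb_sum Γ hadd F hsub Finset.univ a ha _ s2.1 P
  refine ⟨_, s3.1, ?_, ?_⟩
  · intro l
    have h2 : ∑ j, r j * (if l = j then (1:ℤ) else 0) = r l := by simp
    have h3 : ∑ j, (P j : ℤ) * (a j l : ℤ) + ∑ j, (Q j : ℤ) * (b j l : ℤ) =
        ∑ j, U j * (a j l : ℤ) + ∑ j, V j * (b j l : ℤ) + r l := by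
      rw [← h2, ← Finset.sum_add_distrib, ← Finset.sum_add_distrib, ← Finset.sum_add_distrib]
      refine Finset.sum_congr rfl fun j _ => ?_
      rw [hab j l, ← hPe, ← hQe]; ring
    simp only [Pi.add_apply, Finset.sum_apply, Pi.smul_apply, smul_eq_mul, Pi.zero_apply, add_zero]
    push_cast
    rw [← add_assoc, h3]
    simp only [hr]; ring
  · have b1 : ∀ {ι : Type} [Fintype ι] (W : ι → ℕ) (w : ι → ℝ) (f : ι → ℝ),
        (∀ j, (W j : ℝ) ≤ t * w j) → ∑ j, (W j : ℝ) * f j ≤ t * ∑ j, w j * |f j| := by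
      intro ι _ W w f h
      rw [Finset.mul_sum]
      refine Finset.sum_le_sum fun j _ => ?_
      calc (W j : ℝ) * f j ≤ W j * |f j| :=
            mul_le_mul_of_nonneg_left (le_abs_self _) (Nat.cast_nonneg _)
        _ ≤ (t * w j) * |f j| := mul_le_mul_of_nonneg_right (h j) (abs_nonneg _)
        _ = _ := by ring
    have q1 := b1 P (fun j => u j + ε) (fun j => F (a j)) (fun j => by
      have : (P j : ℝ) = U j + r j := by exact_mod_cast (hPe j).symm
      rw [this]; linarith [hU1 j, (abs_le.1 (hrb j)).2])
    have q2 := b1 Q (fun j => v j + ε) (fun j => F (b j)) (fun j => by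
      have : (Q j : ℝ) = V j - r j := by exact_mod_cast (hQe j).symm
      rw [this]; linarith [hV1 j, (abs_le.1 (hrb j)).1])
    have q3 := b1 N c (fun j => F (g j)) hN1
    have q4 : F 0 ≤ t * |F 0| := by nlinarith [le_abs_self (F 0), abs_nonneg (F 0)]
    have : A * t = t * ∑ j, (u j + ε) * |F (a j)| + t * ∑ j, (v j + ε) * |F (b j)| +
      t * ∑ i, c i * |F (g i)| + t * |F 0| := by rw [hA]; ring
    rw [this]
    linarith [s1.2, s2.2, s3.2]

/-- Comparison of two elements near the ray. -/
lemma cheb_compare {d : ℕ} (Γ : Set (Fin (d+1) → ℕ))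
    (h0 : (0 : Fin (d+1) → ℕ) ∈ Γ)
    (hadd : ∀ x ∈ Γ, ∀ y ∈ Γ, x + y ∈ Γ)
    (hgen : AddSubgroup.closure
        ((fun γ : Fin (d+1) → ℕ => (fun i => (γ i : ℤ))) '' Γ) = ⊤)
    (F : (Fin (d+1) → ℕ) → ℝ) (B : ℝ) (hB : 0 ≤ B)
    (hsub : ∀ x ∈ Γ, ∀ y ∈ Γ, F (x + y) ≤ F x + F y)
    (α : Fin d → ℝ) (hα : α ∈ interior (deltaOf Γ)) (ε : ℝ) (hε : 0 < ε) :
    ∃ κ > 0, ∀ y ∈ Γ, ∀ M : ℕ, 0 < M →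
      (∀ l, |(y l : ℝ) / M - (Fin.snoc α (1:ℝ) : Fin (d+1) → ℝ) l| ≤ κ) → -B ≤ F y / M →
      ∃ R : ℝ, ∀ x ∈ Γ, ∀ m : ℕ, R ≤ m → 0 < m →
        (∀ l, |(x l : ℝ) / m - (Fin.snoc α (1:ℝ) : Fin (d+1) → ℝ) l| ≤ κ) →
        F x / m ≤ F y / M + ε := by
  obtain ⟨δ, A, R, hδ, hA, hR, key⟩ := cheb_key Γ h0 hadd hgen F hsub α hα
  set p : Fin (d+1) → ℝ := Fin.snoc α (1:ℝ) with hpdef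
  obtain ⟨η, hη0, hη1, hη⟩ : ∃ η : ℝ, 0 < η ∧ η < 1 ∧ η * (A + B + 1) ≤ ε := by
    have hs : 0 < A + B + 1 := by linarith
    refine ⟨min (1/2) (ε / (A + B + 1)), by positivity, ?_, ?_⟩
    · exact (min_le_left _ _).trans_lt (by norm_num)
    · rw [← le_div_iff₀ hs]; exact min_le_right _ _
  refine ⟨δ * η / 3, by positivity, ?_⟩
  intro y hy M hM hyp hyB
  have hM' : (0:ℝ) < M := by exact_mod_cast hM
  refine ⟨R / η + (∑ l, (y l : ℝ)) / (δ * η / 3) + |F y| / η, ?_⟩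
  intro x hx m hRm hm hxp
  have hm' : (0:ℝ) < m := by exact_mod_cast hm
  have n1 : 0 ≤ R / η := by positivity
  have n2 : 0 ≤ (∑ l, (y l : ℝ)) / (δ * η / 3) := by positivity
  have n3 : 0 ≤ |F y| / η := by positivity
  have m1 : R ≤ η * m := by rw [mul_comm, ← div_le_iff₀ hη0]; linarith
  have m2 : ∑ l, (y l : ℝ) ≤ m * (δ * η / 3) := by
    rw [← div_le_iff₀ (by positivity)]; linarith
  have m3 : |F y| ≤ m * η := by rw [← div_le_iff₀ hη0]; linarith
  set s : ℝ := (1 - η) * m / M with hs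
  have hs0 : 0 ≤ s := div_nonneg (mul_nonneg (by linarith) hm'.le) hM'.le
  set q : ℕ := ⌊s⌋₊ with hq
  have q1 : (q : ℝ) ≤ s := Nat.floor_le hs0
  have q2 : s - 1 ≤ q := (Nat.sub_one_lt_floor _).le
  obtain ⟨z, hz, hzr, hzF⟩ := key (η * m) m1 (fun l => (x l : ℤ) - q * y l) (by
    intro l
    push_cast
    have hyl : (y l : ℝ) ≤ m * (δ * η / 3) := le_trans
      (Finset.single_le_sum (f := fun l => (y l : ℝ)) (fun l _ => Nat.cast_nonneg _)
        (Finset.mem_univ l)) m2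
    have hx1 : |(x l : ℝ) - m * p l| ≤ m * (δ * η / 3) := by
      have : (x l : ℝ) - m * p l = m * ((x l : ℝ) / m - p l) := by field_simp
      rw [this, abs_mul, abs_of_pos hm']
      exact mul_le_mul_of_nonneg_left (hxp l) hm'.le
    have hy1 : |(1 - η) * m * p l - s * y l| ≤ m * (δ * η / 3) := by
      have : (1 - η) * m * p l - s * y l = - ((1 - η) * m * ((y l : ℝ) / M - p l)) := by
        rw [hs]; field_simp; ring
      have h1 : 0 ≤ (1 - η) * m := mul_nonneg (by linarith) hm'.le
      rw [this, abs_neg, abs_mul, abs_of_nonneg h1]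
      refine mul_le_mul ?_ (hyp l) (abs_nonneg _) hm'.le
      nlinarith
    have hy2 : |(s - q) * y l| ≤ m * (δ * η / 3) := by
      rw [abs_mul, abs_of_nonneg (sub_nonneg.2 q1), Nat.abs_cast]
      refine le_trans ?_ hyl
      have := Nat.cast_nonneg (α := ℝ) (y l)
      nlinarith
    have : (x l : ℝ) - q * y l - η * m * p l =
      ((x l : ℝ) - m * p l) + ((1 - η) * m * p l - s * y l) + (s - q) * y l := by ring
    rw [this]
    refine (abs_add_three _ _ _).trans ?_
    linarith)
  have hxe : x = q • y + z := by
    funext l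
    have := hzr l
    have h2 : (x l : ℤ) = q * y l + z l := by linarith
    simp only [Pi.add_apply, Pi.smul_apply, smul_eq_mul]
    exact_mod_cast h2
  have hF := (cheb_nsmul Γ hadd F hsub y hy z hz q).2
  rw [← hxe] at hF
  have hqF : (q : ℝ) * F y ≤ s * F y + |F y| := by
    have : (s - q) * (-F y) ≤ 1 * |F y| := by
      calc (s - q) * (-F y) ≤ (s - q) * |F y| :=
            mul_le_mul_of_nonneg_left (neg_le_abs _) (sub_nonneg.2 q1)
        _ ≤ 1 * |F y| := mul_le_mul_of_nonneg_right (by linarith) (abs_nonneg _)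
    have e1 : (s - q) * (-F y) = q * F y - s * F y := by ring
    linarith
  have hsF : s * F y = (1 - η) * m * (F y / M) := by rw [hs]; field_simp
  have hBm : -(F y / M) * (η * m) ≤ B * (η * m) :=
    mul_le_mul_of_nonneg_right (by linarith) (by positivity)
  have hεm : η * (A + B + 1) * m ≤ ε * m := mul_le_mul_of_nonneg_right hη hm'.le
  rw [div_le_iff₀ hm']
  linarith

/-- For a subadditive function `F` on `Γ` bounded below by `C·|γ|`, and for every `α` in the
interior of `Δ(Γ)`, the limit of `F((m_k α_k, m_k))/m_k` exists for every sequence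
`α_k ∈ Λ_{m_k}(Γ)` (encoded by `α_k = β_k / m_k` with `(β_k, m_k) ∈ Γ`) converging to `α`,
and the limit is independent of the sequence. -/
theorem chebyshev_limit_exists (d : ℕ) (hd : 1 ≤ d) (Γ : Set (Fin (d+1) → ℕ))
    (h0 : (0 : Fin (d+1) → ℕ) ∈ Γ)
    (hadd : ∀ x ∈ Γ, ∀ y ∈ Γ, x + y ∈ Γ)
    (hgen : AddSubgroup.closure
        ((fun γ : Fin (d+1) → ℕ => (fun i => (γ i : ℤ))) '' Γ) = ⊤)
    (F : (Fin (d+1) → ℕ) → ℝ) (C : ℝ)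
    (hsub : ∀ x ∈ Γ, ∀ y ∈ Γ, F (x + y) ≤ F x + F y)
    (hlb : ∀ γ ∈ Γ, C * (∑ i, (γ i : ℝ)) ≤ F γ) :
    ∀ α ∈ interior (deltaOf Γ), ∃ L : ℝ,
      ∀ (m : ℕ → ℕ) (β : ℕ → Fin d → ℕ),
        (∀ k, 0 < m k) →
        Tendsto (fun k => m k) atTop atTop →
        (∀ k, Fin.snoc (β k) (m k) ∈ Γ) →
        Tendsto (fun k => (fun i => (β k i : ℝ) / (m k : ℝ))) atTop (nhds α) →
        Tendsto (fun k => F (Fin.snoc (β k) (m k)) / (m k : ℝ)) atTop (nhds L) := by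
  intro α hα
  set p : Fin (d+1) → ℝ := Fin.snoc α (1:ℝ) with hpdef
  set l : Filter ((Fin (d+1) → ℕ) × ℕ) :=
    comap (fun z => z.2) atTop ⊓ comap (fun z => fun i => (z.1 i : ℝ) / (z.2 : ℝ)) (𝓝 p) ⊓
      𝓟 {z | z.1 ∈ Γ} with hl
  set f : (Fin (d+1) → ℕ) × ℕ → ℝ := fun z => F z.1 / z.2 with hf
  have lm : Tendsto (fun z : (Fin (d+1) → ℕ) × ℕ => z.2) l atTop :=
    tendsto_comap.mono_left (inf_le_left.trans inf_le_left)
  have lp : Tendsto (fun z : (Fin (d+1) → ℕ) × ℕ => fun i => (z.1 i : ℝ) / (z.2 : ℝ)) l (𝓝 p) :=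
    tendsto_comap.mono_left (inf_le_left.trans inf_le_right)
  have lΓ : ∀ᶠ z in l, z.1 ∈ Γ :=
    Eventually.filter_mono inf_le_right (eventually_principal.2 fun z hz => hz)
  have lpos : ∀ᶠ z in l, 0 < z.2 := lm.eventually (eventually_gt_atTop 0)
  have lclose : ∀ κ > 0, ∀ᶠ z in l, ∀ i, |(z.1 i : ℝ) / (z.2 : ℝ) - p i| ≤ κ := by
    intro κ hκ
    filter_upwards [lp.eventually (Metric.closedBall_mem_nhds p hκ)] with z hz i
    have := (dist_le_pi_dist _ _ i).trans (Metric.mem_closedBall.1 hz)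
    rwa [Real.dist_eq] at this
  set B : ℝ := |C| * ∑ i, (|p i| + 1) with hBdef
  have hB : 0 ≤ B := by positivity
  have lB : ∀ᶠ z in l, -B ≤ f z := by
    filter_upwards [lΓ, lpos, lclose 1 one_pos] with z h1 h2 h3
    have h2' : (0:ℝ) < z.2 := by exact_mod_cast h2
    have h4 : C * (∑ i, (z.1 i : ℝ)) / z.2 ≤ f z := div_le_div_of_nonneg_right (hlb _ h1) h2'.le
    refine le_trans ?_ h4
    rw [mul_div_assoc, Finset.sum_div]
    apply neg_le_of_abs_le
    rw [abs_mul]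
    refine mul_le_mul_of_nonneg_left ?_ (abs_nonneg _)
    refine (Finset.abs_sum_le_sum_abs _ _).trans (Finset.sum_le_sum fun i _ => ?_)
    have := h3 i
    have h5 := abs_add_le ((z.1 i : ℝ) / (z.2 : ℝ) - p i) (p i)
    rw [sub_add_cancel] at h5
    linarith
  have lcmp : ∀ ε > 0, ∀ᶠ y in l, ∀ᶠ x in l, f x ≤ f y + ε := by
    intro ε hε
    obtain ⟨κ, hκ, H⟩ := cheb_compare Γ h0 hadd hgen F B hB hsub α hα ε hε
    filter_upwards [lΓ, lpos, lclose κ hκ, lB] with y y1 y2 y3 y4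
    obtain ⟨R, hR⟩ := H y.1 y1 y.2 y2 y3 y4
    filter_upwards [lΓ, lpos, lclose κ hκ,
      (tendsto_natCast_atTop_atTop.comp lm).eventually (eventually_ge_atTop R)] with x x1 x2 x3 x4
    exact hR x.1 x1 x.2 x4 x2 x3
  have main : ∃ L, Tendsto f l (𝓝 L) := by
    rcases l.eq_or_neBot with hbot | hne
    · exact ⟨0, by rw [hbot]; exact tendsto_bot⟩
    have bdb : IsBoundedUnder (· ≥ ·) l f := ⟨-B, by simpa using lB⟩
    have bda : IsBoundedUnder (· ≤ ·) l f := by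
      obtain ⟨y, hy⟩ := (lcmp 1 one_pos).exists
      exact ⟨f y + 1, by simpa using hy⟩
    refine ⟨liminf f l, tendsto_of_le_liminf_of_limsup_le le_rfl ?_ bda bdb⟩
    refine le_of_forall_pos_le_add fun ε hε => ?_
    rw [← sub_le_iff_le_add]
    refine le_liminf_of_le bda.isCoboundedUnder_ge ?_
    filter_upwards [lcmp ε hε] with y hy
    rw [sub_le_iff_le_add]
    exact limsup_le_of_le bdb.isCoboundedUnder_le hy
  obtain ⟨L, hL⟩ := main
  refine ⟨L, fun m β hm hmt hΓ hβ => ?_⟩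
  have ht : Tendsto (fun k => ((Fin.snoc (β k) (m k) : Fin (d+1) → ℕ), m k)) atTop l := by
    refine tendsto_inf.2 ⟨tendsto_inf.2 ⟨tendsto_comap_iff.2 hmt, tendsto_comap_iff.2 ?_⟩,
      tendsto_principal.2 (Eventually.of_forall hΓ)⟩
    rw [tendsto_pi_nhds] at hβ ⊢
    intro i
    refine Fin.lastCases ?_ (fun i => ?_) i
    · refine tendsto_const_nhds.congr fun k => ?_
      have : (m k : ℝ) ≠ 0 := by exact_mod_cast (hm k).ne'
      simp [hpdef, this]
    · simpa [hpdef, Function.comp_def] using hβ i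
  exact hL.comp ht
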